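/- arXiv:2201.11369 — 10 statements merged into one kernel-verified Lean document; each statement's English description precedes it below -/
import Mathlib

section
/- Let n, m ≥ 1, let H : 𝔽₂ⁿ → 𝔽₂^m be an 𝔽₂-linear map where 𝔽₂ = ZMod 2, and let C = ker H. Suppose there exist reals D > 0 and K ≥ 1 such that for every c₁ in the image of H with Hamming weight |c₁| < D there exists c₂ ∈ 𝔽₂ⁿ with H(c₂) = c₁ and |c₂| ≤ K·|c₁|. Then, setting s = min(n/(K·m), D/m), every x ∈ 𝔽₂ⁿ satisfies (1/m)·|H(x)| ≥ (s/n)·d(x, C), where d(x, C) = min_{c ∈ C} |x − c|. -/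
/-- linear locally testable distance implies constant soundness.
The distance `d(x, C)` to the code `C = ker H` is expressed by exhibiting a
codeword `c` realizing `(s/n)·|x − c| ≤ (1/m)·|H x|` (the minimum over the
nonempty finite code is attained, so this is equivalent). -/
theorem locally_testable_distance_implies_soundness
    (n m : ℕ) (hn : 1 ≤ n) (hm : 1 ≤ m)
    (H : (Fin n → ZMod 2) →ₗ[ZMod 2] (Fin m → ZMod 2))
    (D K : ℝ) (hD : 0 < D) (hK : 1 ≤ K)
    (hLT : ∀ c₁ ∈ LinearMap.range H, (hammingNorm c₁ : ℝ) < D →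
      ∃ c₂ : Fin n → ZMod 2, H c₂ = c₁ ∧ (hammingNorm c₂ : ℝ) ≤ K * (hammingNorm c₁ : ℝ)) :
    ∀ x : Fin n → ZMod 2, ∃ c ∈ LinearMap.ker H,
      (min ((n : ℝ) / (K * m)) (D / m) / n) * (hammingDist x c : ℝ) ≤
        (1 / m) * (hammingNorm (H x) : ℝ) := by
  intro x
  have hn' : (0:ℝ) < n := by exact_mod_cast hn
  have hm' : (0:ℝ) < m := by exact_mod_cast hm
  have hK' : (0:ℝ) < K := by linarith
  by_cases h : (hammingNorm (H x) : ℝ) < D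
  · obtain ⟨c₂, h1, h2⟩ := hLT (H x) ⟨x, rfl⟩ h
    refine ⟨x - c₂, by simp [h1], ?_⟩
    have hd : hammingDist x (x - c₂) = hammingNorm c₂ := by
      rw [hammingDist_comm]
      simp [hammingDist, hammingNorm, sub_eq_self]
    rw [hd]
    calc _ ≤ ((n : ℝ) / (K * m) / n) * (K * (hammingNorm (H x) : ℝ)) := by
          gcongr
          exact min_le_left _ _
      _ = _ := by field_simp
  · push Not at h
    refine ⟨0, by simp, ?_⟩
    have hd : (hammingDist x 0 : ℝ) ≤ n := by
      have := hammingDist_le_card_fintype (x := x) (y := 0)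
      simp only [Fintype.card_fin] at this
      exact_mod_cast this
    calc _ ≤ (D / m / n) * (n : ℝ) := by
          gcongr
          exact min_le_right _ _
      _ = (1 / m) * D := by field_simp
      _ ≤ _ := by gcongr
end

section
/- Let ∂₂ : 𝔽₂ⁿ → 𝔽₂^m and ∂₁ : 𝔽₂^m → 𝔽₂^k be 𝔽₂-linear maps with ∂₁ ∘ ∂₂ = 0, where 𝔽₂ = ZMod 2. Call c ∈ 𝔽₂^m locally minimal if |c + ∂₂(e_i)| ≥ |c| for every standard basis vector e_i of 𝔽₂ⁿ, where |·| is Hamming weight. Suppose D > 0 is such that every nonzero locally minimal c ∈ ker ∂₁ satisfies |c| ≥ D. Then for every c₁ in the image of ∂₂ with |c₁| < D there exists c₂ ∈ 𝔽₂ⁿ with ∂₂(c₂) = c₁ and |c₂| ≤ |c₁|. -/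
/-- locally minimal distance lower-bounds locally testable distance.
`c` is locally minimal if `|c + ∂₂ eᵢ| ≥ |c|` for every standard basis vector
`eᵢ = Pi.single i 1` of `𝔽₂ⁿ`. -/
theorem locally_minimal_implies_locally_testable
    (n m k : ℕ)
    (d₂ : (Fin n → ZMod 2) →ₗ[ZMod 2] (Fin m → ZMod 2))
    (d₁ : (Fin m → ZMod 2) →ₗ[ZMod 2] (Fin k → ZMod 2))
    (hchain : d₁ ∘ₗ d₂ = 0)
    (D : ℝ) (hD : 0 < D)
    (hLM : ∀ c ∈ LinearMap.ker d₁, c ≠ 0 →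
      (∀ i : Fin n, hammingNorm c ≤ hammingNorm (c + d₂ (Pi.single i 1))) →
      D ≤ (hammingNorm c : ℝ)) :
    ∀ c₁ ∈ LinearMap.range d₂, (hammingNorm c₁ : ℝ) < D →
      ∃ c₂ : Fin n → ZMod 2, d₂ c₂ = c₁ ∧ hammingNorm c₂ ≤ hammingNorm c₁ := by
  have key : ∀ N : ℕ, ∀ c₁ ∈ LinearMap.range d₂, hammingNorm c₁ = N → (hammingNorm c₁ : ℝ) < D →
      ∃ c₂ : Fin n → ZMod 2, d₂ c₂ = c₁ ∧ hammingNorm c₂ ≤ hammingNorm c₁ := by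
    intro N
    induction N using Nat.strong_induction_on with
    | _ N ih =>
      intro c₁ hc hN hlt
      by_cases h0 : c₁ = 0
      · exact ⟨0, by simp [h0], by simp⟩
      have hker : c₁ ∈ LinearMap.ker d₁ := by
        obtain ⟨x, rfl⟩ := hc
        exact LinearMap.congr_fun hchain x
      have hex : ∃ i : Fin n, hammingNorm (c₁ + d₂ (Pi.single i 1)) < hammingNorm c₁ := by
        by_contra! hcon
        exact absurd (hLM c₁ hker h0 hcon) (not_le.mpr hlt)
      obtain ⟨i, hi⟩ := hex
      have hi' : (hammingNorm (c₁ + d₂ (Pi.single i 1)) : ℝ) < hammingNorm c₁ := by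
        exact_mod_cast hi
      obtain ⟨y, hy, hyn⟩ := ih _ (hN ▸ hi) (c₁ + d₂ (Pi.single i 1))
        (Submodule.add_mem _ hc ⟨_, rfl⟩) rfl (hi'.trans hlt)
      refine ⟨y - Pi.single i 1, by rw [map_sub, hy, add_sub_cancel_right], ?_⟩
      have h1 : hammingNorm (Pi.single i 1 : Fin n → ZMod 2) ≤ 1 := by
        unfold hammingNorm
        refine Finset.card_le_one.mpr ?_
        intro a ha b hb
        simp [Pi.single_apply] at ha hb
        rw [ha, hb]
      have h2 := hammingDist_triangle y 0 (Pi.single i 1 : Fin n → ZMod 2)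
      rw [hammingDist_zero_right, hammingDist_zero_left, hammingDist_eq_hammingNorm] at h2
      have h3 : -y + (Pi.single i 1 : Fin n → ZMod 2) = y - Pi.single i 1 := by
        funext j
        simp only [Pi.add_apply, Pi.neg_apply, Pi.sub_apply]
        generalize (Pi.single i 1 : Fin n → ZMod 2) j = b
        generalize y j = a
        revert a b
        decide
      rw [h3] at h2
      omega
  intro c₁ hc hlt
  exact key _ c₁ hc rfl hlt
end

section
/- Let w₁ and w₂ be positive integers, let ∂₂ : 𝔽₂ⁿ → 𝔽₂^{m₁} × 𝔽₂^{m₂} and ∂₁ : 𝔽₂^{m₁} × 𝔽₂^{m₂} → 𝔽₂^k be 𝔽₂-linear maps with ∂₁ ∘ ∂₂ = 0, where 𝔽₂ = ZMod 2. For c = (u, v) ∈ 𝔽₂^{m₁} × 𝔽₂^{m₂} define the weighted weight |c|_w = |u|/w₁ + |v|/w₂ (with |·| Hamming weight), and call c weighted locally minimal if |c + ∂₂(e_i)|_w ≥ |c|_w for every standard basis vector e_i of 𝔽₂ⁿ. Suppose D > 0 is such that every nonzero weighted locally minimal c ∈ ker ∂₁ satisfies |c|_w ≥ D. Then for every c₁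 in the image of ∂₂ with |c₁|_w < D there exists c₂ ∈ 𝔽₂ⁿ with ∂₂(c₂) = c₁ and |c₂| ≤ w₁·w₂·|c₁|_w. -/
/-- Weighted weight `|(u, v)|_w = |u|/w₁ + |v|/w₂` of a pair of 𝔽₂-vectors. -/
noncomputable def wtNorm {m₁ m₂ : ℕ} (w₁ w₂ : ℕ)
    (c : (Fin m₁ → ZMod 2) × (Fin m₂ → ZMod 2)) : ℝ :=
  (hammingNorm c.1 : ℝ) / w₁ + (hammingNorm c.2 : ℝ) / w₂

theorem wt_nat {m₁ m₂ : ℕ} (w₁ w₂ : ℕ) (hw₁ : 0 < w₁) (hw₂ : 0 < w₂)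
    (c : (Fin m₁ → ZMod 2) × (Fin m₂ → ZMod 2)) :
    (w₁ : ℝ) * w₂ * wtNorm w₁ w₂ c =
      ((w₂ * hammingNorm c.1 + w₁ * hammingNorm c.2 : ℕ) : ℝ) := by
  have h1 : (w₁ : ℝ) ≠ 0 := by positivity
  have h2 : (w₂ : ℝ) ≠ 0 := by positivity
  unfold wtNorm
  push_cast
  field_simp

theorem hamming_add_single {n : ℕ} (x : Fin n → ZMod 2) (i : Fin n) :
    hammingNorm (x + Pi.single i 1) ≤ hammingNorm x + 1 := by
  unfold hammingNorm
  refine le_trans (Finset.card_le_card (t := insert i (Finset.univ.filter fun j => x j ≠ 0)) ?_)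
    (Finset.card_insert_le _ _)
  intro j hj
  by_cases hij : j = i
  · simp [hij]
  · simpa [hij] using hj

/-- weighted locally minimal distance lower-bounds weighted locally
testable distance.  `c` is weighted locally minimal if `|c + ∂₂ eᵢ|_w ≥ |c|_w`
for every standard basis vector `eᵢ = Pi.single i 1` of `𝔽₂ⁿ`. -/
theorem weighted_locally_minimal_implies_locally_testable
    (w₁ w₂ : ℕ) (hw₁ : 0 < w₁) (hw₂ : 0 < w₂)
    (n m₁ m₂ k : ℕ)
    (d₂ : (Fin n → ZMod 2) →ₗ[ZMod 2] (Fin m₁ → ZMod 2) × (Fin m₂ → ZMod 2))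
    (d₁ : ((Fin m₁ → ZMod 2) × (Fin m₂ → ZMod 2)) →ₗ[ZMod 2] (Fin k → ZMod 2))
    (hchain : d₁ ∘ₗ d₂ = 0)
    (D : ℝ) (hD : 0 < D)
    (hLM : ∀ c ∈ LinearMap.ker d₁, c ≠ 0 →
      (∀ i : Fin n, wtNorm w₁ w₂ c ≤ wtNorm w₁ w₂ (c + d₂ (Pi.single i 1))) →
      D ≤ wtNorm w₁ w₂ c) :
    ∀ c₁ ∈ LinearMap.range d₂, wtNorm w₁ w₂ c₁ < D →
      ∃ c₂ : Fin n → ZMod 2, d₂ c₂ = c₁ ∧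
        (hammingNorm c₂ : ℝ) ≤ (w₁ : ℝ) * w₂ * wtNorm w₁ w₂ c₁ := by
  have hpos : (0 : ℝ) < (w₁ : ℝ) * w₂ := by positivity
  have key : ∀ N : ℕ, ∀ c₁ ∈ LinearMap.range d₂,
      w₂ * hammingNorm c₁.1 + w₁ * hammingNorm c₁.2 = N → wtNorm w₁ w₂ c₁ < D →
      ∃ c₂ : Fin n → ZMod 2, d₂ c₂ = c₁ ∧ hammingNorm c₂ ≤ N := by
    intro N
    induction N using Nat.strong_induction_on with
    | _ N ih =>
      intro c hc hN hlt
      by_cases h0 : c = 0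
      · exact ⟨0, by simp [h0], by simp⟩
      have hker : c ∈ LinearMap.ker d₁ := by
        obtain ⟨x, rfl⟩ := hc
        have := LinearMap.congr_fun hchain x
        simpa using this
      have hex : ∃ i : Fin n, wtNorm w₁ w₂ (c + d₂ (Pi.single i 1)) < wtNorm w₁ w₂ c := by
        by_contra hcon
        push Not at hcon
        exact absurd (hLM c hker h0 hcon) (not_le.mpr hlt)
      obtain ⟨i, hi⟩ := hex
      have hi2 := mul_lt_mul_of_pos_left hi hpos
      rw [wt_nat w₁ w₂ hw₁ hw₂, wt_nat w₁ w₂ hw₁ hw₂, Nat.cast_lt, hN] at hi2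
      obtain ⟨y, hy, hyN⟩ := ih _ hi2 (c + d₂ (Pi.single i 1))
        (Submodule.add_mem _ hc ⟨_, rfl⟩) rfl (hi.trans hlt)
      refine ⟨y + Pi.single i 1, ?_, ?_⟩
      · rw [map_add, hy, add_assoc, ← map_add]
        have : (Pi.single i 1 + Pi.single i 1 : Fin n → ZMod 2) = 0 := by
          ext j
          exact CharTwo.add_self_eq_zero _
        rw [this]
        simp
      · have := hamming_add_single y i
        omega
  intro c hc hlt
  obtain ⟨y, hy, hyN⟩ := key _ c hc rfl hlt
  refine ⟨y, hy, ?_⟩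
  rw [wt_nat w₁ w₂ hw₁ hw₂]
  exact_mod_cast hyN
end

section
/- Let G be a finite group and let X = (V_{X,0}, V_{X,1}, E_X) and Y = (V_{Y,0}, V_{Y,1}, E_Y) be finite bipartite graphs, each with a free edge-preserving G-action. Form the balanced product: V_{αβ} = (V_{X,α} × V_{Y,β})/G for α, β ∈ {0,1}, with edge sets E_{*0} = {([x₀,y₀], [x₁,y₀]) : (x₀,x₁) ∈ E_X, y₀ ∈ V_{Y,0}}, E_{0*} = {([x₀,y₀], [x₀,y₁]) : x₀ ∈ V_{X,0}, (y₀,y₁) ∈ E_Y}, and face set F = {([x₀,y₀], [x₁,y₀], [x₀,y₁], [x₁,y₁]) : (x₀,x₁) ∈ E_X, (y₀,y₁) ∈ E_Y}. Then for all u ∈ V₀₀, v ∈ V₁₀, t ∈ V₀₁ with (u, v) ∈ E_{*0} and (u, t) ∈ E_{0*}, there exists a unique z ∈ V₁₁ such that (u, v, t, z) ∈ F. -/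
/-- The balanced product vertex set `(X × Y)/G` (quotient by the diagonal action). -/
def BPQuot (G : Type*) [Group G] (X Y : Type*) [MulAction G X] [MulAction G Y] : Type _ :=
  Quotient (MulAction.orbitRel G (X × Y))

/-- The class `[x, y]` in `(X × Y)/G`. -/
def bpMk (G : Type*) [Group G] {X Y : Type*} [MulAction G X] [MulAction G Y]
    (x : X) (y : Y) : BPQuot G X Y :=
  Quotient.mk (MulAction.orbitRel G (X × Y)) (x, y)

theorem bpMk_eq_iff {G X Y : Type*} [Group G] [MulAction G X] [MulAction G Y]
    (x x' : X) (y y' : Y) :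
    bpMk G x y = bpMk G x' y' ↔ ∃ g : G, g • x' = x ∧ g • y' = y := by
  unfold bpMk
  constructor
  · intro h
    obtain ⟨g, hg⟩ := MulAction.orbitRel_apply.1 (Quotient.exact h)
    exact ⟨g, congrArg Prod.fst hg, congrArg Prod.snd hg⟩
  · rintro ⟨g, rfl, rfl⟩
    exact Quotient.sound (MulAction.orbitRel_apply.2 ⟨g, rfl⟩)

/-- square completion in a balanced product.  Given vertices
`u ∈ V₀₀`, `v ∈ V₁₀`, `t ∈ V₀₁` with `(u,v) ∈ E_{*0}` and `(u,t) ∈ E_{0*}`,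
there is a unique `z ∈ V₁₁` with `(u,v,t,z)` a face. -/
theorem square_completion
    (G : Type) [Group G] [Finite G]
    (VX₀ VX₁ VY₀ VY₁ : Type) [Finite VX₀] [Finite VX₁] [Finite VY₀] [Finite VY₁]
    [MulAction G VX₀] [MulAction G VX₁] [MulAction G VY₀] [MulAction G VY₁]
    (EX : Set (VX₀ × VX₁)) (EY : Set (VY₀ × VY₁))
    (hpresX : ∀ (g : G) (x₀ : VX₀) (x₁ : VX₁), (x₀, x₁) ∈ EX → (g • x₀, g • x₁) ∈ EX)
    (hpresY : ∀ (g : G) (y₀ : VY₀) (y₁ : VY₁), (y₀, y₁) ∈ EY → (g • y₀, g • y₁) ∈ EY)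
    (hfreeX₀ : ∀ (g : G) (x : VX₀), g • x = x → g = 1)
    (hfreeX₁ : ∀ (g : G) (x : VX₁), g • x = x → g = 1)
    (hfreeY₀ : ∀ (g : G) (y : VY₀), g • y = y → g = 1)
    (hfreeY₁ : ∀ (g : G) (y : VY₁), g • y = y → g = 1)
    (u : BPQuot G VX₀ VY₀) (v : BPQuot G VX₁ VY₀) (t : BPQuot G VX₀ VY₁)
    (huv : (u, v) ∈ {p : BPQuot G VX₀ VY₀ × BPQuot G VX₁ VY₀ |
      ∃ (x₀ : VX₀) (x₁ : VX₁) (y₀ : VY₀), (x₀, x₁) ∈ EX ∧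
        p = (bpMk G x₀ y₀, bpMk G x₁ y₀)})
    (hut : (u, t) ∈ {p : BPQuot G VX₀ VY₀ × BPQuot G VX₀ VY₁ |
      ∃ (x₀ : VX₀) (y₀ : VY₀) (y₁ : VY₁), (y₀, y₁) ∈ EY ∧
        p = (bpMk G x₀ y₀, bpMk G x₀ y₁)}) :
    ∃! z : BPQuot G VX₁ VY₁,
      (u, v, t, z) ∈ {q : BPQuot G VX₀ VY₀ × BPQuot G VX₁ VY₀ ×
                          BPQuot G VX₀ VY₁ × BPQuot G VX₁ VY₁ |
        ∃ (x₀ : VX₀) (x₁ : VX₁) (y₀ : VY₀) (y₁ : VY₁),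
          (x₀, x₁) ∈ EX ∧ (y₀, y₁) ∈ EY ∧
          q = (bpMk G x₀ y₀, bpMk G x₁ y₀, bpMk G x₀ y₁, bpMk G x₁ y₁)} := by
  obtain ⟨x₀, x₁, y₀, hx, h1⟩ := huv
  obtain ⟨a₀, b₀, b₁, hb, h2⟩ := hut
  obtain ⟨rfl, rfl⟩ := Prod.mk.inj h1
  obtain ⟨h3, rfl⟩ := Prod.mk.inj h2
  obtain ⟨g, rfl, rfl⟩ := (bpMk_eq_iff _ _ _ _).1 h3
  have ht : bpMk G a₀ b₁ = bpMk G (g • a₀) (g • b₁) :=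
    ((bpMk_eq_iff _ _ _ _).2 ⟨g, rfl, rfl⟩).symm
  refine ⟨bpMk G x₁ (g • b₁), ⟨g • a₀, x₁, g • b₀, g • b₁, hx, hpresY _ _ _ hb, ?_⟩, ?_⟩
  · rw [ht]
  · rintro z ⟨c₀, c₁, d₀, d₁, hc, hd, h⟩
    obtain ⟨e1, h⟩ := Prod.mk.inj h
    obtain ⟨e2, h⟩ := Prod.mk.inj h
    obtain ⟨e3, rfl⟩ := Prod.mk.inj h
    rw [ht] at e3
    obtain ⟨k, k1, k2⟩ := (bpMk_eq_iff _ _ _ _).1 e1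
    obtain ⟨l, l1, l2⟩ := (bpMk_eq_iff _ _ _ _).1 e2
    obtain ⟨m, m1, m2⟩ := (bpMk_eq_iff _ _ _ _).1 e3
    have hl : k⁻¹ * l = 1 := hfreeY₀ _ d₀ (by rw [mul_smul, l2, ← k2, inv_smul_smul])
    have hm : k⁻¹ * m = 1 := hfreeX₀ _ c₀ (by rw [mul_smul, m1, ← k1, inv_smul_smul])
    have hl' : k = l := inv_mul_eq_one.1 hl
    have hm' : k = m := inv_mul_eq_one.1 hm
    subst hl' hm'
    exact ((bpMk_eq_iff _ _ _ _).2 ⟨k, l1, m2⟩).symm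
end

section
/- Let (V₀, V₁, E) be a (w₀, w₁)-regular finite bipartite graph that is a 1-sided (c, ε)-lossless expander from V₀ to V₁. Then every subset S ⊆ V₀ with |S| < c·|V₀| has at least (1−2ε)·w₀·|S| unique neighbors, i.e. |N^unique(S)| ≥ (1−2ε)·w₀·|S|. -/
/-- Neighborhood of a set `S ⊆ V₀` in a bipartite graph with edge set `E ⊆ V₀ × V₁`. -/
def Nbhd {V₀ V₁ : Type*} (E : Set (V₀ × V₁)) (S : Set V₀) : Set V₁ :=
  {x₁ | ∃ x₀ ∈ S, (x₀, x₁) ∈ E}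

/-- Unique neighbors of `S ⊆ V₀`: vertices of `V₁` adjacent to exactly one element of `S`. -/
def UniqueNbhd {V₀ V₁ : Type*} (E : Set (V₀ × V₁)) (S : Set V₀) : Set V₁ :=
  {x₁ | ∃! x₀, x₀ ∈ S ∧ (x₀, x₁) ∈ E}

/-- Every left vertex has exactly `w₀` neighbors. -/
def LeftRegular {V₀ V₁ : Type*} (E : Set (V₀ × V₁)) (w₀ : ℕ) : Prop :=
  ∀ x₀ : V₀, Nat.card {x₁ : V₁ | (x₀, x₁) ∈ E} = w₀

/-- Every right vertex has exactly `w₁` neighbors. -/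
def RightRegular {V₀ V₁ : Type*} (E : Set (V₀ × V₁)) (w₁ : ℕ) : Prop :=
  ∀ x₁ : V₁, Nat.card {x₀ : V₀ | (x₀, x₁) ∈ E} = w₁

/-- a 1-sided `(c, ε)`-lossless expander has at least
`(1 − 2ε)·w₀·|S|` unique neighbors for every small set `S`. -/
theorem lossless_implies_unique_expander
    (V₀ V₁ : Type) [Finite V₀] [Finite V₁] (E : Set (V₀ × V₁))
    (w₀ w₁ : ℕ) (hreg₀ : LeftRegular E w₀) (hreg₁ : RightRegular E w₁)
    (c ε : ℝ)
    (hlossless : ∀ S : Set V₀, (Nat.card S : ℝ) < c * Nat.card V₀ →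
      (1 - ε) * (w₀ : ℝ) * (Nat.card S : ℝ) ≤ (Nat.card (Nbhd E S) : ℝ)) :
    ∀ S : Set V₀, (Nat.card S : ℝ) < c * Nat.card V₀ →
      (1 - 2 * ε) * (w₀ : ℝ) * (Nat.card S : ℝ) ≤ (Nat.card (UniqueNbhd E S) : ℝ) := by
  classical
  intro S hS
  have h1 := hlossless S hS
  have key : 2 * Nat.card (Nbhd E S) ≤ Nat.card (UniqueNbhd E S) + w₀ * Nat.card S := by
    haveI := Fintype.ofFinite V₀
    haveI := Fintype.ofFinite V₁
    have hN : Nat.card (Nbhd E S) = ∑ x : V₁, if x ∈ Nbhd E S then 1 else 0 := by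
      rw [Nat.card_eq_fintype_card, Fintype.card_subtype, Finset.card_filter]
    have hU : Nat.card (UniqueNbhd E S) = ∑ x : V₁, if x ∈ UniqueNbhd E S then 1 else 0 := by
      rw [Nat.card_eq_fintype_card, Fintype.card_subtype, Finset.card_filter]
    have hD : w₀ * Nat.card S
        = ∑ x : V₁, (Finset.univ.filter (fun y : V₀ => y ∈ S ∧ (y, x) ∈ E)).card := by
      have hd : ∀ y : V₀, (∑ x : V₁, if (y, x) ∈ E then 1 else 0) = w₀ := by
        intro y
        rw [← hreg₀ y, Nat.card_eq_fintype_card, Fintype.card_subtype, Finset.card_filter]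
        rfl
      simp_rw [Finset.card_filter]
      rw [Finset.sum_comm, Nat.card_eq_fintype_card, Fintype.card_subtype, Finset.card_filter,
        Finset.mul_sum]
      refine Finset.sum_congr rfl fun y _ => ?_
      by_cases hy : y ∈ S
      · simp only [hy, true_and, if_true, mul_one]
        exact (hd y).symm
      · simp [hy]
    rw [hN, hU, hD, Finset.mul_sum, ← Finset.sum_add_distrib]
    refine Finset.sum_le_sum fun x _ => ?_
    by_cases hx : x ∈ Nbhd E S
    · obtain ⟨y, hy, hyx⟩ := hx
      have hmem : y ∈ Finset.univ.filter (fun y : V₀ => y ∈ S ∧ (y, x) ∈ E) := by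
        simp [hy, hyx]
      have hpos := Finset.card_pos.mpr ⟨y, hmem⟩
      by_cases hu : x ∈ UniqueNbhd E S
      · rw [if_pos hu]
        split_ifs <;> omega
      · have h2 : (Finset.univ.filter (fun y : V₀ => y ∈ S ∧ (y, x) ∈ E)).card ≠ 1 := by
          intro h
          obtain ⟨z, hz⟩ := Finset.card_eq_one.mp h
          apply hu
          have hall : ∀ t, (t ∈ S ∧ (t, x) ∈ E) ↔ t = z := by
            intro t
            have := Finset.ext_iff.mp hz t
            simpa using this
          exact ⟨z, (hall z).2 rfl, fun t ht => (hall t).1 ht⟩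
        split_ifs <;> omega
    · rw [if_neg hx]
      omega
  have key' : (2 : ℝ) * Nat.card (Nbhd E S)
      ≤ Nat.card (UniqueNbhd E S) + w₀ * Nat.card S := by exact_mod_cast key
  linarith
end

section
/- Let n ∈ ℕ and let a, a', b, b' : Fin n → ℝ be nonnegative antitone sequences (a_k ≥ a_{k+1}, etc.) such that for every k ≤ n, Σ_{l < k} a(l) ≤ Σ_{l < k} a'(l) and Σ_{l < k} b(l) ≤ Σ_{l < k} b'(l). Then Σ_{k} a(k)·b(k) ≤ Σ_{k} a'(k)·b'(k). -/
open Finset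

theorem abel_aux (n : ℕ) (c d : ℕ → ℝ) (hc : Antitone c)
    (hd : ∀ k ≤ n, 0 ≤ ∑ i ∈ Finset.range k, d i) :
    ∀ k ≤ n, c k * ∑ i ∈ Finset.range k, d i ≤ ∑ i ∈ Finset.range k, c i * d i := by
  intro k
  induction k with
  | zero => simp
  | succ k ih =>
    intro hk
    have h1 := ih (by omega)
    have h2 := mul_le_mul_of_nonneg_right (hc (Nat.le_succ k)) (hd (k+1) hk)
    rw [Finset.sum_range_succ] at h2 ⊢
    rw [Finset.sum_range_succ]
    simp only [Nat.succ_eq_add_one] at h2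
    linarith

theorem abel_fin (n : ℕ) (c x y : Fin n → ℝ) (hc0 : ∀ k, 0 ≤ c k) (hc : Antitone c)
    (hd : ∀ k : ℕ, k ≤ n →
      ∑ l ∈ Finset.univ.filter (fun l : Fin n => (l : ℕ) < k), x l ≤
      ∑ l ∈ Finset.univ.filter (fun l : Fin n => (l : ℕ) < k), y l) :
    ∑ k : Fin n, c k * x k ≤ ∑ k : Fin n, c k * y k := by
  let C : ℕ → ℝ := fun i => if h : i < n then c ⟨i, h⟩ else 0
  let D : ℕ → ℝ := fun i => if h : i < n then y ⟨i, h⟩ - x ⟨i, h⟩ else 0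
  have hC : Antitone C := by
    intro i j hij
    by_cases hj : j < n
    · have hi : i < n := by omega
      simp only [C, hi, hj, dif_pos]
      exact hc (by simpa using hij)
    · by_cases hi : i < n
      · simp [C, hi, hj, hc0]
      · simp [C, hi, hj]
  have hCl : ∀ l : Fin n, C l = c l := fun l => by simp [C]
  have hDl : ∀ l : Fin n, D l = y l - x l := fun l => by simp [D]
  have hD : ∀ k ≤ n, 0 ≤ ∑ i ∈ Finset.range k, D i := by
    intro k hk
    have e : ∑ i ∈ Finset.range k, D i =
        ∑ l ∈ Finset.univ.filter (fun l : Fin n => (l : ℕ) < k), (y l - x l) := by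
      rw [Finset.sum_filter]
      simp only [← hDl]
      rw [Fin.sum_univ_eq_sum_range (fun i => if i < k then D i else 0) n, ← Finset.sum_filter]
      congr 1
      ext i
      simp only [Finset.mem_range, Finset.mem_filter]
      omega
    rw [e, Finset.sum_sub_distrib]
    linarith [hd k hk]
  have h := abel_aux n C D hC hD n le_rfl
  have h0 : C n = 0 := by simp [C]
  rw [h0, zero_mul, ← Fin.sum_univ_eq_sum_range (fun i => C i * D i) n] at h
  simp only [hCl, hDl, mul_sub, Finset.sum_sub_distrib] at h
  linarith

/-- summation-by-parts inequality — if the nonnegative antitone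
sequences `a'` and `b'` dominate the initial partial sums of the nonnegative
antitone sequences `a` and `b`, then `Σ a·b ≤ Σ a'·b'`. -/
theorem partial_sum_domination_product
    (n : ℕ) (a a' b b' : Fin n → ℝ)
    (ha : ∀ k, 0 ≤ a k) (ha' : ∀ k, 0 ≤ a' k)
    (hb : ∀ k, 0 ≤ b k) (hb' : ∀ k, 0 ≤ b' k)
    (haA : Antitone a) (ha'A : Antitone a') (hbA : Antitone b) (hb'A : Antitone b')
    (hab : ∀ k : ℕ, k ≤ n →
      ∑ l ∈ Finset.univ.filter (fun l : Fin n => (l : ℕ) < k), a l ≤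
      ∑ l ∈ Finset.univ.filter (fun l : Fin n => (l : ℕ) < k), a' l)
    (hbb : ∀ k : ℕ, k ≤ n →
      ∑ l ∈ Finset.univ.filter (fun l : Fin n => (l : ℕ) < k), b l ≤
      ∑ l ∈ Finset.univ.filter (fun l : Fin n => (l : ℕ) < k), b' l) :
    ∑ k : Fin n, a k * b k ≤ ∑ k : Fin n, a' k * b' k := by
  have h1 := abel_fin n a b b' ha haA hbb
  have h2 := abel_fin n b' a a' hb' hb'A hab
  simp only [mul_comm (b' _)] at h2
  exact h1.trans h2
end

section
/- Let (V₀, V₁, E) be a (w₀, w₁)-regular finite bipartite graph that is a 1-sided (c, ε)-lossless expander from V₀ to V₁, and let L : (V₀ → ZMod 2) → (V₁ → ZMod 2) be its adjacency map. Then every x : V₀ → ZMod 2 with Hamming weight |x| < c·|V₀| satisfies |L(x)| ≥ (1−2ε)·w₀·|x|. -/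
open Classical in
/-- The `ZMod 2` adjacency map: `(L x)(x₁) = Σ_{x₀ : (x₀,x₁) ∈ E} x(x₀)`. -/
noncomputable def adjMap {V₀ V₁ : Type*} [Fintype V₀] (E : Set (V₀ × V₁))
    (x : V₀ → ZMod 2) : V₁ → ZMod 2 :=
  fun x₁ => ∑ x₀ : V₀, if (x₀, x₁) ∈ E then x x₀ else 0

/-- for `x` of small Hamming weight, `|L x| ≥ (1 − 2ε)·w₀·|x|`
in a 1-sided `(c, ε)`-lossless expander. -/
theorem expander_code_small_weight_bound
    (V₀ V₁ : Type) [Fintype V₀] [Fintype V₁] (E : Set (V₀ × V₁))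
    (w₀ w₁ : ℕ) (hreg₀ : LeftRegular E w₀) (hreg₁ : RightRegular E w₁)
    (c ε : ℝ)
    (hlossless : ∀ S : Set V₀, (Nat.card S : ℝ) < c * Nat.card V₀ →
      (1 - ε) * (w₀ : ℝ) * (Nat.card S : ℝ) ≤ (Nat.card (Nbhd E S) : ℝ)) :
    ∀ x : V₀ → ZMod 2, (hammingNorm x : ℝ) < c * Nat.card V₀ →
      (1 - 2 * ε) * (w₀ : ℝ) * (hammingNorm x : ℝ) ≤ (hammingNorm (adjMap E x) : ℝ) := by
  classical
  intro x hx
  set S : Finset V₀ := Finset.univ.filter (fun i => x i ≠ 0) with hS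
  have hSc : hammingNorm x = S.card := by
    simp only [hammingNorm, hS]
  have hcS : Nat.card (↑(S : Set V₀)) = S.card := by simp
  have hN := hlossless (S : Set V₀) (by rw [hcS, ← hSc]; exact hx)
  rw [hcS] at hN
  have hNc : Nat.card (Nbhd E (S : Set V₀)) =
      ∑ v : V₁, if v ∈ Nbhd E (S : Set V₀) then 1 else 0 := by
    rw [Nat.card_eq_fintype_card, Fintype.card_subtype, Finset.card_filter]
  have hLc : hammingNorm (adjMap E x) = ∑ v : V₁, if adjMap E x v ≠ 0 then 1 else 0 := by
    rw [← Finset.card_filter]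
    simp only [hammingNorm]
  have hd : ∑ v : V₁, (S.filter (fun u => (u, v) ∈ E)).card = w₀ * S.card := by
    simp only [Finset.card_filter]
    rw [Finset.sum_comm]
    have : ∀ u ∈ S, (∑ v : V₁, if (u, v) ∈ E then 1 else 0) = w₀ := by
      intro u _
      rw [← hreg₀ u, ← Finset.card_filter, Nat.card_eq_fintype_card]
      exact (Fintype.card_subtype _).symm
    rw [Finset.sum_congr rfl this]
    simp [mul_comm]
  have hL : ∀ v, adjMap E x v = ((S.filter (fun u => (u, v) ∈ E)).card : ZMod 2) := by
    intro v
    have h2 : ∀ a : ZMod 2, a ≠ 0 → a = 1 := by decide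
    rw [Finset.card_filter, hS, Finset.sum_filter]
    push_cast
    unfold adjMap
    refine Finset.sum_congr rfl fun u _ => ?_
    by_cases h : x u = 0
    · simp [h]
    · simp [h2 _ h]
  have hpt : ∀ v, 2 * (if v ∈ Nbhd E (S : Set V₀) then 1 else 0) ≤
      (S.filter (fun u => (u, v) ∈ E)).card + (if adjMap E x v ≠ 0 then 1 else 0) := by
    intro v
    by_cases hv : v ∈ Nbhd E (S : Set V₀)
    · obtain ⟨u, hu, huv⟩ := id hv
      have hpos : 0 < (S.filter (fun u => (u, v) ∈ E)).card :=
        Finset.card_pos.2 ⟨u, Finset.mem_filter.2 ⟨hu, huv⟩⟩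
      rw [if_pos hv]
      by_cases h1 : (S.filter (fun u => (u, v) ∈ E)).card = 1
      · have : adjMap E x v ≠ 0 := by rw [hL, h1]; decide
        rw [if_pos this]; omega
      · omega
    · rw [if_neg hv]; omega
  have hsum := Finset.sum_le_sum (fun v (_ : v ∈ Finset.univ) => hpt v)
  rw [← Finset.mul_sum, Finset.sum_add_distrib, hd, ← hNc, ← hLc] at hsum
  have hr : (2 : ℝ) * (Nat.card (Nbhd E (S : Set V₀)) : ℝ) ≤
      w₀ * S.card + hammingNorm (adjMap E x) := by exact_mod_cast hsum
  rw [hSc]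
  linarith
end

section
/- With the explicit balanced-product chain complex data (G; R₀, R₁, S₀, S₁; A; B; graphs Γ_{*0}, Γ_{*1}, Γ_{0*}, Γ_{1*}; maps L_{*0}, L_{*1}, L_{0*}, L_{1*}, ∂₂, ∂₁), assume: (i) Γ_{*0} and Γ_{*1} are (w↓, w↑)-regular and Γ_{0*} and Γ_{1*} are (w→, w←)-regular, where 1 ≤ w↓ < w↑ and 1 ≤ w→ < w← are integers; (ii) there are reals c↓, c→ > 0 and ε↓, ε→ > 0 with ε↓·w↓ ≥ 1 and ε→·w→ ≥ 1 such that: every S ⊆ V₀₀ with |S| < c↓·|G|·|R₀| has at least (1−ε↓)·w↓·|S| neighbors in Γ_{*0}; every S ⊆ V₀₁ with |S| < c↓·|G|·|R₀| has at least (1−ε↓)·w↓·|S| neighbors in Γ_{*1}; every S ⊆ V₀₀ with |S| < c→·|G|·|S₀| has at least (1−ε→)·w→·|S| neighbors in Γ_{0*}; and every S ⊆ V₁₀ with |S| < c→·|G|·|S₀| has at least (1−ε→)·w→·|S| neighbors in Γ_{1*}; (iii) ε > 0 satisfies w↑·ε→ ≤ ε and ε↓ ≤ ε. Let c₁ = (v₁₀,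 v₀₁) ∈ C₁₀ × C₀₁ be weighted locally minimal with Hamming weights |v₁₀| < min(c↓·|G|·|R₀|/w↑, c→·|G|·|S₀|) and |v₀₁| < min(c→·|G|·|S₀|/w←, c↓·|G|·|R₀|). Then the Hamming weight of c₀ = ∂₁(v₁₀, v₀₁) satisfies |c₀| ≥ (1/2 − 8ε)·(w→·|v₁₀| + w↓·|v₀₁|); equivalently (1/2 − 8ε)·(|v₁₀|/w↓ + |v₀₁|/w→) ≤ |c₀|/(w↓·w→). -/
open Finset

/-- Edges of `Γ_{*0}` (resp. `Γ_{*1}`): `((h,r₀,s), (a⁻¹h,r₁,s))` for `a ∈ A(r₀,r₁)`. -/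
def edgesA {G R₀ R₁ : Type} [Group G] (A : R₀ × R₁ → Finset G) (S : Type) :
    Set ((G × R₀ × S) × (G × R₁ × S)) :=
  {p | ∃ (h : G) (r₀ : R₀) (r₁ : R₁) (s : S) (a : G),
    a ∈ A (r₀, r₁) ∧ p = ((h, r₀, s), (a⁻¹ * h, r₁, s))}

/-- Edges of `Γ_{0*}` (resp. `Γ_{1*}`): `((h,r,s₀), (hb,r,s₁))` for `b ∈ B(s₀,s₁)`. -/
def edgesB {G S₀ S₁ : Type} [Group G] (B : S₀ × S₁ → Finset G) (R : Type) :
    Set ((G × R × S₀) × (G × R × S₁)) :=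
  {p | ∃ (h : G) (r : R) (s₀ : S₀) (s₁ : S₁) (b : G),
    b ∈ B (s₀, s₁) ∧ p = ((h, r, s₀), (h * b, r, s₁))}

/-- The `ZMod 2` adjacency map of `Γ_{*0}` / `Γ_{*1}`. -/
def adjA {G R₀ R₁ : Type} [Group G] [Fintype R₀] (A : R₀ × R₁ → Finset G) (S : Type)
    (x : G × R₀ × S → ZMod 2) : G × R₁ × S → ZMod 2 :=
  fun p => ∑ r₀ : R₀, ∑ a ∈ A (r₀, p.2.1), x (a * p.1, r₀, p.2.2)

/-- The `ZMod 2` adjacency map of `Γ_{0*}` / `Γ_{1*}`. -/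
def adjB {G S₀ S₁ : Type} [Group G] [Fintype S₀] (B : S₀ × S₁ → Finset G) (R : Type)
    (x : G × R × S₀ → ZMod 2) : G × R × S₁ → ZMod 2 :=
  fun p => ∑ s₀ : S₀, ∑ b ∈ B (s₀, p.2.2), x (p.1 * b⁻¹, p.2.1, s₀)

section Helpers
open Classical

noncomputable def dgL {V W : Type*} (E : Set (V × W)) (X : Finset W) (z : V) : ℕ :=
  #{x ∈ X | (z, x) ∈ E}

noncomputable def dgR {V W : Type*} (E : Set (V × W)) (T : Finset V) (q : W) : ℕ :=
  #{z ∈ T | (z, q) ∈ E}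

noncomputable def sp {V : Type*} [Fintype V] (x : V → ZMod 2) : Finset V := {v | x v ≠ 0}

lemma card_sp {V : Type*} [Fintype V] (x : V → ZMod 2) : hammingNorm x = #(sp x) := by
  unfold hammingNorm sp; congr

lemma leftreg_dg {V W : Type*} [Fintype W] {E : Set (V × W)} {w : ℕ} (h : LeftRegular E w)
    (z : V) : dgL E univ z = w := by
  rw [← h z, dgL, Nat.card_eq_fintype_card, Fintype.card_subtype]; congr

lemma rightreg_dg {V W : Type*} [Fintype V] {E : Set (V × W)} {w : ℕ} (h : RightRegular E w)
    (q : W) : dgR E univ q = w := by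
  rw [← h q, dgR, Nat.card_eq_fintype_card, Fintype.card_subtype]; congr

lemma sum_dg {V W : Type*} (E : Set (V × W)) (T : Finset V) (X : Finset W) :
    ∑ z ∈ T, dgL E X z = ∑ q ∈ X, dgR E T q :=
  Finset.sum_card_bipartiteAbove_eq_sum_card_bipartiteBelow (fun z q => (z, q) ∈ E)

lemma nbhd_card {V W : Type*} [Fintype V] [Fintype W] (E : Set (V × W)) (T : Finset V) :
    Nat.card (Nbhd E (T : Set V)) = ∑ q : W, if 0 < dgR E T q then 1 else 0 := by
  rw [Nat.card_eq_fintype_card, Fintype.card_subtype, Finset.card_filter]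
  apply Finset.sum_congr rfl
  intro q _
  congr 1
  simp [Nbhd, dgR, Finset.card_pos, Finset.Nonempty]

lemma excess {V W : Type*} [Fintype V] [Fintype W] {E : Set (V × W)} {w : ℕ}
    (h : LeftRegular E w) (T : Finset V) (X : Finset W) (e : ℝ)
    (hT : (1 - e) * w * (#T : ℝ) ≤ (Nat.card (Nbhd E (T : Set V)) : ℝ)) :
    ∑ z ∈ T, ((dgL E X z : ℝ) - e * w) ≤ #X := by
  have h1 : ∑ q : W, dgR E T q = #T * w := by
    rw [← sum_dg, Finset.sum_congr rfl (fun z _ => leftreg_dg h z)]; simp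
  have h2 : Nat.card (Nbhd E (T : Set V)) + ∑ q ∈ X, dgR E T q ≤ #X + ∑ q : W, dgR E T q := by
    rw [nbhd_card, ← Finset.sum_add_sum_compl X (fun q => dgR E T q),
      ← Finset.sum_add_sum_compl X (fun q => if 0 < dgR E T q then 1 else 0)]
    have a1 : ∑ q ∈ X, (if 0 < dgR E T q then 1 else 0) ≤ #X := by
      rw [Finset.card_eq_sum_ones]; exact Finset.sum_le_sum fun q _ => by split_ifs <;> simp
    have a2 : ∑ q ∈ Xᶜ, (if 0 < dgR E T q then 1 else 0) ≤ ∑ q ∈ Xᶜ, dgR E T q :=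
      Finset.sum_le_sum fun q _ => by split_ifs <;> omega
    omega
  rw [h1, ← sum_dg] at h2
  have h3 : ((Nat.card (Nbhd E (T : Set V)) : ℝ)) + ∑ z ∈ T, (dgL E X z : ℝ) ≤ #X + #T * w := by
    exact_mod_cast h2
  rw [Finset.sum_sub_distrib]
  simp only [Finset.sum_const, nsmul_eq_mul]
  nlinarith

lemma oddcount {V W : Type*} [Fintype V] [Fintype W] {E : Set (V × W)} {w : ℕ}
    (h : LeftRegular E w) (T : Finset V) (e : ℝ)
    (hT : (1 - e) * w * (#T : ℝ) ≤ (Nat.card (Nbhd E (T : Set V)) : ℝ)) :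
    (1 - 2 * e) * w * (#T : ℝ) ≤ (#{q : W | Odd (dgR E T q)} : ℝ) := by
  have h1 : ∑ q : W, dgR E T q = #T * w := by
    rw [← sum_dg, Finset.sum_congr rfl (fun z _ => leftreg_dg h z)]; simp
  have h2 : 2 * Nat.card (Nbhd E (T : Set V)) ≤ #{q : W | Odd (dgR E T q)} + #T * w := by
    rw [nbhd_card, ← h1, Finset.card_filter, Finset.mul_sum, ← Finset.sum_add_distrib]
    refine Finset.sum_le_sum fun q _ => ?_
    by_cases h0 : 0 < dgR E T q
    · by_cases ho : Odd (dgR E T q)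
      · simp [h0, ho]; omega
      · have : dgR E T q ≠ 1 := by intro h; rw [h] at ho; exact ho odd_one
        simp [h0, ho]; omega
    · simp [h0]
  have h3 : 2 * (Nat.card (Nbhd E (T : Set V)) : ℝ) ≤ #{q : W | Odd (dgR E T q)} + #T * w := by
    exact_mod_cast h2
  nlinarith

lemma zcase (v : ZMod 2) : v = 0 ∨ v = 1 := by revert v; decide

/-- sum in ZMod 2 as a parity -/
lemma zsum {V W : Type*} [Fintype V] (E : Set (V × W)) (x : V → ZMod 2) (q : W) :
    (∑ z : V, if (z, q) ∈ E then x z else 0) = (dgR E (sp x) q : ZMod 2) := by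
  rw [dgR, sp, Finset.filter_filter, Finset.card_filter]
  push_cast
  refine Finset.sum_congr rfl fun z _ => ?_
  rcases zcase (x z) with h | h <;> simp [h]

lemma memA {G R₀ R₁ : Type} [Group G] (A : R₀ × R₁ → Finset G) (S : Type)
    (z : G × R₀ × S) (q : G × R₁ × S) :
    (z, q) ∈ edgesA A S ↔ z.2.2 = q.2.2 ∧ z.1 * q.1⁻¹ ∈ A (z.2.1, q.2.1) := by
  obtain ⟨h, r, s⟩ := z
  obtain ⟨h', r', s'⟩ := q
  simp only [edgesA, Set.mem_ofPred_eq, Prod.mk.injEq]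
  constructor
  · rintro ⟨_, _, _, _, a, ha, ⟨rfl, rfl, rfl⟩, rfl, rfl, rfl⟩
    simpa using ha
  · rintro ⟨rfl, ha⟩
    exact ⟨h, r, r', s, _, ha, ⟨rfl, rfl, rfl⟩, by group, rfl, rfl⟩

lemma memB {G S₀ S₁ : Type} [Group G] (B : S₀ × S₁ → Finset G) (R : Type)
    (z : G × R × S₀) (q : G × R × S₁) :
    (z, q) ∈ edgesB B R ↔ z.2.1 = q.2.1 ∧ z.1⁻¹ * q.1 ∈ B (z.2.2, q.2.2) := by
  obtain ⟨h, r, s⟩ := z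
  obtain ⟨h', r', s'⟩ := q
  simp only [edgesB, Set.mem_ofPred_eq, Prod.mk.injEq]
  constructor
  · rintro ⟨_, _, _, _, a, ha, ⟨rfl, rfl, rfl⟩, rfl, rfl, rfl⟩
    simpa using ha
  · rintro ⟨rfl, ha⟩
    exact ⟨h, r, s, s', _, ha, ⟨rfl, rfl, rfl⟩, by group, rfl, rfl⟩

lemma adjA_eq {G R₀ R₁ : Type} [Group G] [Fintype G] [Fintype R₀] (A : R₀ × R₁ → Finset G)
    (S : Type) [Fintype S] (x : G × R₀ × S → ZMod 2) (q : G × R₁ × S) :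
    adjA A S x q = (dgR (edgesA A S) (sp x) q : ZMod 2) := by
  rw [← zsum]
  obtain ⟨h', r', s'⟩ := q
  simp only [memA, adjA, Fintype.sum_prod_type]
  rw [Finset.sum_comm]
  refine Finset.sum_congr rfl fun r _ => ?_
  rw [← Equiv.sum_comp (Equiv.mulRight h')]
  simp [ite_and]

lemma adjB_eq {G S₀ S₁ : Type} [Group G] [Fintype G] [Fintype S₀] (B : S₀ × S₁ → Finset G)
    (R : Type) [Fintype R] (x : G × R × S₀ → ZMod 2) (q : G × R × S₁) :
    adjB B R x q = (dgR (edgesB B R) (sp x) q : ZMod 2) := by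
  rw [← zsum]
  obtain ⟨h', r', s'⟩ := q
  simp only [memB, adjB, Fintype.sum_prod_type]
  conv_rhs =>
    enter [2, g]
    rw [Finset.sum_comm]
  conv_rhs => rw [Finset.sum_comm]
  refine Finset.sum_congr rfl fun r _ => ?_
  rw [← Equiv.sum_comp ((Equiv.inv G).trans (Equiv.mulLeft h'))]
  simp [ite_and]

lemma sp_single {V : Type*} [Fintype V] [DecidableEq V] (z : V) :
    sp (Pi.single z (1 : ZMod 2)) = {z} := by
  ext v; simp [sp, Pi.single_apply]

lemma dgR_single {V W : Type*} (E : Set (V × W)) (z : V) (q : W) :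
    dgR E {z} q = if (z, q) ∈ E then 1 else 0 := by
  rw [dgR, Finset.filter_singleton]; split_ifs <;> simp

/-- weight after a flip -/
lemma flip_weight {V W : Type*} [Fintype V] [Fintype W] {E : Set (V × W)} {w : ℕ}
    (h : LeftRegular E w) (z : V) (v u : W → ZMod 2)
    (hu : ∀ q, u q = ((if (z, q) ∈ E then 1 else 0 : ℕ) : ZMod 2)) :
    hammingNorm (v + u) + 2 * dgL E (sp v) z = hammingNorm v + w := by
  rw [← leftreg_dg h z, card_sp, card_sp, sp, sp, dgL, dgL, Finset.filter_filter,
    Finset.card_filter, Finset.card_filter, Finset.card_filter, Finset.card_filter,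
    Finset.mul_sum, ← Finset.sum_add_distrib, ← Finset.sum_add_distrib]
  refine Finset.sum_congr rfl fun q _ => ?_
  rw [Pi.add_apply, hu]
  have h2 : (1 : ZMod 2) + 1 = 0 := by decide
  rcases zcase (v q) with h | h <;> by_cases hE : (z, q) ∈ E <;> simp [h, hE, h2]

lemma odd_support {W : Type*} [Fintype W] (f g : W → ℕ) (u : W → ZMod 2)
    (hu : ∀ q, u q = (f q : ZMod 2) + (g q : ZMod 2)) :
    #{q | Odd (f q)} + #{q | Odd (g q)} = hammingNorm u + 2 * #{q | Odd (f q) ∧ Odd (g q)} := by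
  rw [card_sp, sp, Finset.card_filter, Finset.card_filter, Finset.card_filter, Finset.card_filter,
    Finset.mul_sum, ← Finset.sum_add_distrib, ← Finset.sum_add_distrib]
  refine Finset.sum_congr rfl fun q _ => ?_
  have : u q ≠ 0 ↔ Odd (f q + g q) := by
    rw [hu, ← Nat.cast_add, ← ZMod.natCast_eq_one_iff_odd]
    rcases zcase ((f q + g q : ℕ) : ZMod 2) with h | h <;> rw [h] <;> simp
  rw [if_congr this rfl rfl]
  by_cases h1 : Odd (f q) <;> by_cases h2 : Odd (g q) <;> simp [Nat.odd_add, h1, h2, ← Nat.not_odd_iff_even]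

lemma pos_part_sum {V W : Type*} [Fintype V] [Fintype W] {E : Set (V × W)} {w wu : ℕ}
    (hw : 1 ≤ w) (hl : LeftRegular E w) (hr : RightRegular E wu) (X : Finset W) (e c : ℝ)
    (he : 0 < e)
    (hexp : ∀ S : Set V, (Nat.card S : ℝ) < c →
      (1 - e) * (w : ℝ) * (Nat.card S : ℝ) ≤ (Nat.card (Nbhd E S) : ℝ))
    (hX : (#X : ℝ) * wu < c) :
    ∑ z : V, max ((dgL E X z : ℝ) / w - e) 0 ≤ (#X : ℝ) / w := by
  have hw' : (0 : ℝ) < w := by exact_mod_cast hw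
  set T : Finset V := {z | e < (dgL E X z : ℝ) / w} with hTdef
  have hsum : ∑ z : V, dgL E X z = #X * wu := by
    rw [sum_dg, Finset.sum_congr rfl (fun z _ => rightreg_dg hr z)]; simp
  have hTc : #T ≤ #X * wu := by
    rw [← hsum, hTdef, Finset.card_filter]
    refine Finset.sum_le_sum fun z _ => ?_
    split_ifs with h
    · by_contra h0
      have : dgL E X z = 0 := by omega
      rw [this] at h; simp at h; linarith
    · simp
  have hTc' : (#T : ℝ) ≤ #X * wu := by exact_mod_cast hTc
  have := excess hl T X e (by
    have := hexp (T : Set V) (by simpa using hTc'.trans_lt hX)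
    simpa using this)
  rw [le_div_iff₀ hw', Finset.sum_mul]
  refine le_trans (le_of_eq ?_) this
  rw [hTdef, Finset.sum_filter]
  refine Finset.sum_congr rfl fun z _ => ?_
  split_ifs with h
  · rw [max_eq_left (by linarith)]; field_simp
  · rw [max_eq_right (by linarith)]; simp

lemma ptwise (α β ed er ε : ℝ) (hα : 0 ≤ α) (hβ : 0 ≤ β) (hab : α + β ≤ 1) (hed : 0 < ed)
    (her : 0 < er) (h1 : ed ≤ ε) (h2 : er ≤ ε) :
    α * β ≤ (1 / 4 + ε) * max (α - ed) 0 + (1 / 4 + 2 * ε) * max (β - er) 0 + 2 * er * α := by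
  have hε : 0 < ε := by linarith
  have m1 : 0 ≤ max (α - ed) 0 := le_max_right _ _
  have m2 : 0 ≤ max (β - er) 0 := le_max_right _ _
  rcases le_or_gt β (2 * er) with hb | hb
  · have : α * β ≤ 2 * er * α := by nlinarith
    have : 0 ≤ (1 / 4 + ε) * max (α - ed) 0 := by positivity
    have : 0 ≤ (1 / 4 + 2 * ε) * max (β - er) 0 := by positivity
    linarith
  · rw [max_eq_left (by linarith : 0 ≤ β - er)]
    have p : 0 ≤ er * α := by positivity
    rcases le_or_gt α ed with ha | ha
    · have : 0 ≤ (1 / 4 + ε) * max (α - ed) 0 := by positivity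
      have : α * β ≤ ε * β := by nlinarith
      have : ε * (2 * er) ≤ ε * β := by nlinarith
      nlinarith
    · rw [max_eq_left (by linarith : 0 ≤ α - ed)]
      obtain ⟨a, rfl⟩ : ∃ a, α = a + ed := ⟨α - ed, by ring⟩
      obtain ⟨b, rfl⟩ : ∃ b, β = b + er := ⟨β - er, by ring⟩
      simp only [add_sub_cancel_right]
      have ha' : 0 < a := by linarith
      have hb' : er < b := by linarith
      have q1 : a * b ≤ (a + b) / 4 := by nlinarith [sq_nonneg (a - b)]
      have q2 : ed * b ≤ ε * b := by nlinarith
      have q3 : er * a ≤ ε * a := by nlinarith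
      have q4 : ed * er ≤ ε * b := by nlinarith
      nlinarith

lemma overlap {G R₀ R₁ S₀ S₁ : Type} [Group G] [Fintype G] [Fintype R₀] [Fintype R₁] [Fintype S₀]
    [Fintype S₁] (A : R₀ × R₁ → Finset G) (B : S₀ × S₁ → Finset G)
    (X : Finset (G × R₁ × S₀)) (Y : Finset (G × R₀ × S₁)) :
    #{q : G × R₁ × S₁ | Odd (dgR (edgesB B R₁) X q) ∧ Odd (dgR (edgesA A S₁) Y q)} ≤
      ∑ z : G × R₀ × S₀, dgL (edgesA A S₀) X z * dgL (edgesB B R₀) Y z := by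
  have : ∑ z : G × R₀ × S₀, dgL (edgesA A S₀) X z * dgL (edgesB B R₀) Y z =
      #((univ : Finset (G × R₀ × S₀)).sigma fun z =>
        ({x ∈ X | (z, x) ∈ edgesA A S₀} ×ˢ {y ∈ Y | (z, y) ∈ edgesB B R₀})) := by
    simp [dgL, Finset.card_sigma, Finset.card_product]
  rw [this]
  refine Finset.card_le_card_of_surjOn
    (fun t => (t.2.1.1 * t.1.1⁻¹ * t.2.2.1, t.2.1.2.1, t.2.2.2.2)) ?_
  rintro ⟨g, r₁, s₁⟩ hq
  simp only [Finset.coe_filter, Finset.mem_univ, true_and, Set.mem_ofPred_eq] at hq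
  obtain ⟨⟨g1, r1', s₀⟩, hx⟩ := Finset.card_pos.mp hq.1.pos
  obtain ⟨⟨g2, r₀, s1'⟩, hy⟩ := Finset.card_pos.mp hq.2.pos
  simp only [Finset.mem_filter, memA, memB] at hx hy
  obtain ⟨hx, rfl, hb⟩ := hx
  obtain ⟨hy, rfl, ha⟩ := hy
  refine ⟨⟨(g2 * g⁻¹ * g1, r₀, s₀), ((g1, r1', s₀), (g2, r₀, s1'))⟩, ?_, ?_⟩
  · simp [memA, memB, hx, hy, mul_assoc, ha, hb]
  · simp [mul_assoc]

end Helpers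

/-- the small set LTC lemma — for a weighted locally minimal and
small `c₁ = (v₁₀, v₀₁)`, the weight of `c₀ = ∂₁ c₁` satisfies
`|c₀| ≥ (1/2 − 8ε)·(w→·|v₁₀| + w↓·|v₀₁|)`. -/
theorem small_set_LTC
    (G : Type) [Group G] [Fintype G] [DecidableEq G]
    (R₀ R₁ S₀ S₁ : Type) [Fintype R₀] [Fintype R₁] [Fintype S₀] [Fintype S₁]
    [DecidableEq R₀] [DecidableEq R₁] [DecidableEq S₀] [DecidableEq S₁]
    (A : R₀ × R₁ → Finset G) (B : S₀ × S₁ → Finset G)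
    (wd wu wr wl : ℕ) (hwd : 1 ≤ wd) (hdu : wd < wu) (hwr : 1 ≤ wr) (hrl : wr < wl)
    -- (i) regularity of the four graphs
    (hreg1 : LeftRegular (edgesA A S₀) wd) (hreg2 : RightRegular (edgesA A S₀) wu)
    (hreg3 : LeftRegular (edgesA A S₁) wd) (hreg4 : RightRegular (edgesA A S₁) wu)
    (hreg5 : LeftRegular (edgesB B R₀) wr) (hreg6 : RightRegular (edgesB B R₀) wl)
    (hreg7 : LeftRegular (edgesB B R₁) wr) (hreg8 : RightRegular (edgesB B R₁) wl)
    -- (ii) expansion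
    (cd cr εd εr : ℝ) (hcd : 0 < cd) (hcr : 0 < cr) (hεd : 0 < εd) (hεr : 0 < εr)
    (hεdwd : 1 ≤ εd * wd) (hεrwr : 1 ≤ εr * wr)
    (hexp1 : ∀ S : Set (G × R₀ × S₀),
      (Nat.card S : ℝ) < cd * ((Fintype.card G : ℝ) * (Fintype.card R₀ : ℝ)) →
      (1 - εd) * (wd : ℝ) * (Nat.card S : ℝ) ≤ (Nat.card (Nbhd (edgesA A S₀) S) : ℝ))
    (hexp2 : ∀ S : Set (G × R₀ × S₁),
      (Nat.card S : ℝ) < cd * ((Fintype.card G : ℝ) * (Fintype.card R₀ : ℝ)) →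
      (1 - εd) * (wd : ℝ) * (Nat.card S : ℝ) ≤ (Nat.card (Nbhd (edgesA A S₁) S) : ℝ))
    (hexp3 : ∀ S : Set (G × R₀ × S₀),
      (Nat.card S : ℝ) < cr * ((Fintype.card G : ℝ) * (Fintype.card S₀ : ℝ)) →
      (1 - εr) * (wr : ℝ) * (Nat.card S : ℝ) ≤ (Nat.card (Nbhd (edgesB B R₀) S) : ℝ))
    (hexp4 : ∀ S : Set (G × R₁ × S₀),
      (Nat.card S : ℝ) < cr * ((Fintype.card G : ℝ) * (Fintype.card S₀ : ℝ)) →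
      (1 - εr) * (wr : ℝ) * (Nat.card S : ℝ) ≤ (Nat.card (Nbhd (edgesB B R₁) S) : ℝ))
    -- (iii)
    (ε : ℝ) (hε : 0 < ε) (hε1 : (wu : ℝ) * εr ≤ ε) (hε2 : εd ≤ ε)
    -- the vector c₁ = (v₁₀, v₀₁)
    (v10 : G × R₁ × S₀ → ZMod 2) (v01 : G × R₀ × S₁ → ZMod 2)
    -- weighted locally minimal
    (hmin : ∀ z : G × R₀ × S₀,
      (hammingNorm v10 : ℝ) / wd + (hammingNorm v01 : ℝ) / wr ≤
        (hammingNorm (v10 + adjA A S₀ (Pi.single z 1)) : ℝ) / wd +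
        (hammingNorm (v01 + adjB B R₀ (Pi.single z 1)) : ℝ) / wr)
    -- smallness
    (hsmall10 : (hammingNorm v10 : ℝ) <
      min (cd * ((Fintype.card G : ℝ) * (Fintype.card R₀ : ℝ)) / wu)
          (cr * ((Fintype.card G : ℝ) * (Fintype.card S₀ : ℝ))))
    (hsmall01 : (hammingNorm v01 : ℝ) <
      min (cr * ((Fintype.card G : ℝ) * (Fintype.card S₀ : ℝ)) / wl)
          (cd * ((Fintype.card G : ℝ) * (Fintype.card R₀ : ℝ)))) :
    (1 / 2 - 8 * ε) * ((wr : ℝ) * (hammingNorm v10 : ℝ) + (wd : ℝ) * (hammingNorm v01 : ℝ)) ≤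
      (hammingNorm (adjB B R₁ v10 + adjA A S₁ v01) : ℝ) := by
  classical
  have hwd' : (0 : ℝ) < wd := by exact_mod_cast hwd
  have hwr' : (0 : ℝ) < wr := by exact_mod_cast hwr
  have hwu' : (1 : ℝ) ≤ wu := by exact_mod_cast (by omega : 1 ≤ wu)
  have hwl' : (0 : ℝ) < wl := by exact_mod_cast (by omega : 0 < wl)
  have hεrε : εr ≤ ε := by nlinarith
  rw [lt_min_iff, lt_div_iff₀ (by linarith)] at hsmall10
  rw [lt_min_iff, lt_div_iff₀ hwl'] at hsmall01
  -- local minimality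
  have hloc : ∀ z, (dgL (edgesA A S₀) (sp v10) z : ℝ) / wd +
      (dgL (edgesB B R₀) (sp v01) z : ℝ) / wr ≤ 1 := by
    intro z
    have h1 := flip_weight hreg1 z v10 (adjA A S₀ (Pi.single z 1)) (by
      intro q; rw [adjA_eq, sp_single, dgR_single])
    have h2 := flip_weight hreg5 z v01 (adjB B R₀ (Pi.single z 1)) (by
      intro q; rw [adjB_eq, sp_single, dgR_single])
    have h := hmin z
    have h1' : (hammingNorm (v10 + adjA A S₀ (Pi.single z 1)) : ℝ) =
        hammingNorm v10 + wd - 2 * dgL (edgesA A S₀) (sp v10) z := by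
      rw [eq_sub_iff_add_eq]; exact_mod_cast h1
    have h2' : (hammingNorm (v01 + adjB B R₀ (Pi.single z 1)) : ℝ) =
        hammingNorm v01 + wr - 2 * dgL (edgesB B R₀) (sp v01) z := by
      rw [eq_sub_iff_add_eq]; exact_mod_cast h2
    rw [h1', h2', sub_div, sub_div, add_div, add_div, div_self hwd'.ne', div_self hwr'.ne',
      mul_div_assoc, mul_div_assoc] at h
    linarith
  have hodd := odd_support (dgR (edgesB B R₁) (sp v10)) (dgR (edgesA A S₁) (sp v01))
    (adjB B R₁ v10 + adjA A S₁ v01) (by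
      intro q; rw [Pi.add_apply, adjA_eq, adjB_eq])
  have hov := overlap A B (sp v10) (sp v01)
  rw [card_sp v10, card_sp v01] at *
  have hoX := oddcount hreg7 (sp v10) εr (by
    have := hexp4 (sp v10 : Set _) (by simpa using hsmall10.2)
    simpa using this)
  have hoY := oddcount hreg3 (sp v01) εd (by
    have := hexp2 (sp v01 : Set _) (by simpa using hsmall01.2)
    simpa using this)
  have pX := pos_part_sum hwd hreg1 hreg2 (sp v10) εd _ hεd hexp1 hsmall10.1
  have pY := pos_part_sum hwr hreg5 hreg6 (sp v01) εr _ hεr hexp3 hsmall01.1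
  have hsum : ∑ z, (dgL (edgesA A S₀) (sp v10) z : ℝ) / wd = #(sp v10) * wu / wd := by
    rw [← Finset.sum_div]
    congr 1
    have : ∑ z, dgL (edgesA A S₀) (sp v10) z = #(sp v10) * wu := by
      rw [sum_dg, Finset.sum_congr rfl (fun z _ => rightreg_dg hreg2 z)]; simp
    exact_mod_cast this
  have key : ∑ z, (dgL (edgesA A S₀) (sp v10) z : ℝ) / wd *
      ((dgL (edgesB B R₀) (sp v01) z : ℝ) / wr) ≤
      (1 / 4 + 3 * ε) * ((#(sp v10) : ℝ) / wd) + (1 / 4 + 2 * ε) * ((#(sp v01) : ℝ) / wr) := by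
    have h1 := Finset.sum_le_sum (s := univ) fun z _ => ptwise
      ((dgL (edgesA A S₀) (sp v10) z : ℝ) / wd) ((dgL (edgesB B R₀) (sp v01) z : ℝ) / wr)
      εd εr ε (by positivity) (by positivity) (hloc z) hεd hεr hε2 hεrε
    refine h1.trans ?_
    rw [Finset.sum_add_distrib, Finset.sum_add_distrib, ← Finset.mul_sum, ← Finset.mul_sum,
      ← Finset.mul_sum, hsum]
    have e1 := mul_le_mul_of_nonneg_left pX (by positivity : 0 ≤ 1 / 4 + ε)
    have e2 := mul_le_mul_of_nonneg_left pY (by positivity : 0 ≤ 1 / 4 + 2 * ε)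
    have e3 : 2 * εr * (#(sp v10) * wu / wd) ≤ 2 * ε * ((#(sp v10) : ℝ) / wd) := by
      have := mul_le_mul_of_nonneg_right hε1 (by positivity : 0 ≤ (#(sp v10) : ℝ) / wd)
      calc 2 * εr * (#(sp v10) * wu / wd) = 2 * (wu * εr * ((#(sp v10) : ℝ) / wd)) := by ring
        _ ≤ _ := by linarith
    linarith
  have key2 : ((∑ z, dgL (edgesA A S₀) (sp v10) z * dgL (edgesB B R₀) (sp v01) z : ℕ) : ℝ) ≤
      (1 / 4 + 3 * ε) * (wr * #(sp v10)) + (1 / 4 + 2 * ε) * (wd * #(sp v01)) := by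
    have := mul_le_mul_of_nonneg_left key (by positivity : (0 : ℝ) ≤ wd * wr)
    calc _ = (wd * wr : ℝ) * ∑ z, (dgL (edgesA A S₀) (sp v10) z : ℝ) / wd *
      ((dgL (edgesB B R₀) (sp v01) z : ℝ) / wr) := by
          push_cast
          rw [Finset.mul_sum]
          refine Finset.sum_congr rfl fun z _ => ?_
          field_simp
      _ ≤ _ := this
      _ = _ := by field_simp
  have hov' : (#{q : G × R₁ × S₁ | Odd (dgR (edgesB B R₁) (sp v10) q) ∧
      Odd (dgR (edgesA A S₁) (sp v01) q)} : ℝ) ≤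
      ((∑ z, dgL (edgesA A S₀) (sp v10) z * dgL (edgesB B R₀) (sp v01) z : ℕ) : ℝ) := by
    exact_mod_cast hov
  have hodd' : (#{q | Odd (dgR (edgesB B R₁) (sp v10) q)} : ℝ) +
      #{q | Odd (dgR (edgesA A S₁) (sp v01) q)} =
      (hammingNorm (adjB B R₁ v10 + adjA A S₁ v01) : ℝ) +
      2 * #{q : G × R₁ × S₁ | Odd (dgR (edgesB B R₁) (sp v10) q) ∧
      Odd (dgR (edgesA A S₁) (sp v01) q)} := by
    exact_mod_cast hodd
  have f1 : εr * (wr * #(sp v10)) ≤ ε * (wr * #(sp v10)) :=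
    mul_le_mul_of_nonneg_right hεrε (by positivity)
  have f2 : εd * (wd * #(sp v01)) ≤ ε * (wd * #(sp v01)) :=
    mul_le_mul_of_nonneg_right hε2 (by positivity)
  have f3 : 0 ≤ ε * (wd * #(sp v01)) := by positivity
  linarith
end

section
/- Let G be a finite group, R₀, R₁, S₀, S₁ finite types, and for each (r₀,r₁) ∈ R₀ × R₁ a finite subset A(r₀,r₁) ⊆ G and for each (s₀,s₁) ∈ S₀ × S₁ a finite subset B(s₀,s₁) ⊆ G. Suppose there are positive integers w↓, w↑, w→, w← such that Σ_{r₁ ∈ R₁} |A(r₀,r₁)| = w↓ for every r₀ ∈ R₀, Σ_{r₀ ∈ R₀} |A(r₀,r₁)| = w↑ for every r₁ ∈ R₁, Σ_{s₁ ∈ S₁} |B(s₀,s₁)| = w→ for every s₀ ∈ S₀, and Σ_{s₀ ∈ S₀} |B(s₀,s₁)| = w← for every s₁ ∈ S₁. Define C₀₀ = (G × R₀ × S₀ → ZMod 2), C₁₀ = (G × R₁ × S₀ → ZMod 2), C₀₁ = (G × R₀ × S₁ → ZMod 2), the linear maps L₀₀→₁₀(1_{(h,r₀,s₀)}) = Σ_{r₁}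 Σ_{a ∈ A(r₀,r₁)} 1_{(a⁻¹h, r₁, s₀)} and L₀₀→₀₁(1_{(h,r₀,s₀)}) = Σ_{s₁} Σ_{b ∈ B(s₀,s₁)} 1_{(hb, r₀, s₁)}, and ∂₂(c) = (L₀₀→₁₀(c), L₀₀→₀₁(c)). Then the 𝔽₂-dimension of ker ∂₂ satisfies dim(ker ∂₂) ≥ |G|·|R₀|·|S₀|·(1 − w↓/w↑ − w→/w←), as an inequality of real numbers. -/
open Finset

/-- the constant-rate bound for the balanced-product code:
`dim(ker ∂₂) ≥ |G|·|R₀|·|S₀|·(1 − w↓/w↑ − w→/w←)`. -/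
theorem balanced_product_code_rate
    (G : Type) [Group G] [Fintype G] [DecidableEq G]
    (R₀ R₁ S₀ S₁ : Type) [Fintype R₀] [Fintype R₁] [Fintype S₀] [Fintype S₁]
    [DecidableEq R₀] [DecidableEq R₁] [DecidableEq S₀] [DecidableEq S₁]
    (A : R₀ × R₁ → Finset G) (B : S₀ × S₁ → Finset G)
    (wd wu wr wl : ℕ) (hwd : 0 < wd) (hwu : 0 < wu) (hwr : 0 < wr) (hwl : 0 < wl)
    -- degree-sum (regularity) hypotheses
    (hA₀ : ∀ r₀ : R₀, ∑ r₁ : R₁, (A (r₀, r₁)).card = wd)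
    (hA₁ : ∀ r₁ : R₁, ∑ r₀ : R₀, (A (r₀, r₁)).card = wu)
    (hB₀ : ∀ s₀ : S₀, ∑ s₁ : S₁, (B (s₀, s₁)).card = wr)
    (hB₁ : ∀ s₁ : S₁, ∑ s₀ : S₀, (B (s₀, s₁)).card = wl)
    -- the adjacency maps, determined on basis vectors
    (L₀₀₁₀ : (G × R₀ × S₀ → ZMod 2) →ₗ[ZMod 2] (G × R₁ × S₀ → ZMod 2))
    (L₀₀₀₁ : (G × R₀ × S₀ → ZMod 2) →ₗ[ZMod 2] (G × R₀ × S₁ → ZMod 2))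
    (hL₀₀₁₀ : ∀ (h : G) (r₀ : R₀) (s₀ : S₀),
      L₀₀₁₀ (Pi.single (h, r₀, s₀) 1) =
        ∑ r₁ : R₁, ∑ a ∈ A (r₀, r₁), Pi.single (a⁻¹ * h, r₁, s₀) 1)
    (hL₀₀₀₁ : ∀ (h : G) (r₀ : R₀) (s₀ : S₀),
      L₀₀₀₁ (Pi.single (h, r₀, s₀) 1) =
        ∑ s₁ : S₁, ∑ b ∈ B (s₀, s₁), Pi.single (h * b, r₀, s₁) 1)
    -- the boundary map ∂₂
    (d₂ : (G × R₀ × S₀ → ZMod 2) →ₗ[ZMod 2]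
      (G × R₁ × S₀ → ZMod 2) × (G × R₀ × S₁ → ZMod 2))
    (hd₂ : ∀ c, d₂ c = (L₀₀₁₀ c, L₀₀₀₁ c)) :
    (Fintype.card G : ℝ) * (Fintype.card R₀ : ℝ) * (Fintype.card S₀ : ℝ) *
        (1 - (wd : ℝ) / wu - (wr : ℝ) / wl) ≤
      (Module.finrank (ZMod 2) (LinearMap.ker d₂) : ℝ) := by
  have key : ∀ (X Y : Type) [Fintype X] [Fintype Y] (f : X × Y → Finset G) (u v : ℕ), 0 < v →
      (∀ x, ∑ y, (f (x, y)).card = u) → (∀ y, ∑ x, (f (x, y)).card = v) →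
      (Fintype.card X : ℝ) * ((u : ℝ) / v) = Fintype.card Y := by
    intro X Y _ _ f u v hv h1 h2
    have h : Fintype.card X * u = Fintype.card Y * v := by
      have h3 := Finset.sum_comm (s := (Finset.univ : Finset X)) (t := (Finset.univ : Finset Y))
        (f := fun x y => (f (x, y)).card)
      simpa [h1, h2] using h3
    have h' : (Fintype.card X : ℝ) * u = Fintype.card Y * v := by exact_mod_cast h
    have hv' : (v : ℝ) ≠ 0 := by positivity
    field_simp
    linarith
  have hR := key R₀ R₁ A wd wu hwu hA₀ hA₁
  have hS := key S₀ S₁ B wr wl hwl hB₀ hB₁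
  have h1 := LinearMap.finrank_range_add_finrank_ker d₂
  have h2 := Submodule.finrank_le (LinearMap.range d₂)
  simp only [Module.finrank_prod, Module.finrank_fintype_fun_eq_card, Fintype.card_prod] at h1 h2
  have h3 : Fintype.card G * (Fintype.card R₀ * Fintype.card S₀) ≤
      Fintype.card G * (Fintype.card R₁ * Fintype.card S₀) +
      Fintype.card G * (Fintype.card R₀ * Fintype.card S₁) +
      Module.finrank (ZMod 2) (LinearMap.ker d₂) := by omega
  have h4 : (Fintype.card G : ℝ) * (Fintype.card R₀ * Fintype.card S₀) ≤
      Fintype.card G * (Fintype.card R₁ * Fintype.card S₀) +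
      Fintype.card G * (Fintype.card R₀ * Fintype.card S₁) +
      Module.finrank (ZMod 2) (LinearMap.ker d₂) := by exact_mod_cast h3
  rw [← hR, ← hS] at h4
  linarith
end

section
/- Let ι be a finite type and for each i ∈ ι let (V₀ⁱ, V₁ⁱ, Eⁱ) be a finite bipartite graph with |V₀ⁱ| = n₀, and suppose there are reals c > 0 and α ≥ 0 such that for every i and every S ⊆ V₀ⁱ with |S| < c·n₀, |N(S)| ≥ α·|S|. Form the disjoint union bipartite graph with left vertices Σ i, V₀ⁱ, right vertices Σ i, V₁ⁱ, and edges ((i, x₀), (i, x₁)) for (x₀, x₁) ∈ Eⁱ. Then every S ⊆ Σ i, V₀ⁱ with |S| < c·n₀ satisfies |N(S)| ≥ α·|S| in the disjoint union graph. -/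
/-- Edges of the disjoint union of an indexed family of bipartite graphs. -/
def unionEdges {ι : Type*} {V₀ V₁ : ι → Type*}
    (E : ∀ i, Set (V₀ i × V₁ i)) : Set ((Σ i, V₀ i) × (Σ i, V₁ i)) :=
  {p | ∃ (i : _) (x₀ : V₀ i) (x₁ : V₁ i), (x₀, x₁) ∈ E i ∧ p = (⟨i, x₀⟩, ⟨i, x₁⟩)}

theorem card_sigma_set {ι : Type} [Fintype ι] {V : ι → Type} [∀ i, Fintype (V i)]
    (S : Set (Σ i, V i)) : Nat.card S = ∑ i, Nat.card (Sigma.mk i ⁻¹' S : Set (V i)) := by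
  rw [← Nat.card_sigma]
  exact Nat.card_congr
    { toFun := fun x => ⟨x.1.1, ⟨x.1.2, x.2⟩⟩
      invFun := fun y => ⟨⟨y.1, y.2.1⟩, y.2.2⟩
      left_inv := fun _ => rfl
      right_inv := fun _ => rfl }

theorem nbhd_preimage {ι : Type} {V₀ V₁ : ι → Type} (E : ∀ i, Set (V₀ i × V₁ i))
    (S : Set (Σ i, V₀ i)) (i : ι) :
    (Sigma.mk i ⁻¹' Nbhd (unionEdges E) S : Set (V₁ i)) = Nbhd (E i) (Sigma.mk i ⁻¹' S) := by
  ext x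
  constructor
  · rintro ⟨y, hy, j, a, b, hab, h⟩
    obtain ⟨h1, h2⟩ := Prod.mk.inj h
    subst h1
    cases h2
    exact ⟨a, hy, hab⟩
  · rintro ⟨a, ha, hab⟩
    exact ⟨⟨i, a⟩, ha, i, a, x, hab, rfl⟩

/-- small-set vertex expansion with an absolute size threshold is
preserved under disjoint unions of bipartite graphs with equal left sizes. -/
theorem expansion_of_disjoint_union
    (ι : Type) [Fintype ι] (V₀ V₁ : ι → Type)
    [∀ i, Fintype (V₀ i)] [∀ i, Fintype (V₁ i)]
    (E : ∀ i, Set (V₀ i × V₁ i))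
    (n₀ : ℕ) (hcard : ∀ i, Nat.card (V₀ i) = n₀)
    (c α : ℝ) (hc : 0 < c) (hα : 0 ≤ α)
    (hexp : ∀ i, ∀ S : Set (V₀ i), (Nat.card S : ℝ) < c * n₀ →
      α * (Nat.card S : ℝ) ≤ (Nat.card (Nbhd (E i) S) : ℝ)) :
    ∀ S : Set (Σ i, V₀ i), (Nat.card S : ℝ) < c * n₀ →
      α * (Nat.card S : ℝ) ≤ (Nat.card (Nbhd (unionEdges E) S) : ℝ) := by
  intro S hS
  rw [card_sigma_set (Nbhd (unionEdges E) S)]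
  have hle : ∀ i, Nat.card (Sigma.mk i ⁻¹' S : Set (V₀ i)) ≤ Nat.card S := by
    intro i
    rw [card_sigma_set S]
    exact Finset.single_le_sum
      (f := fun i => Nat.card (Sigma.mk i ⁻¹' S : Set (V₀ i)))
      (fun _ _ => Nat.zero_le _) (Finset.mem_univ i)
  have hmain : ∀ i, α * (Nat.card (Sigma.mk i ⁻¹' S : Set (V₀ i)) : ℝ) ≤
      (Nat.card (Sigma.mk i ⁻¹' Nbhd (unionEdges E) S : Set (V₁ i)) : ℝ) := by
    intro i
    rw [nbhd_preimage]
    exact hexp i _ (lt_of_le_of_lt (by exact_mod_cast hle i) hS)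
  rw [card_sigma_set S, Nat.cast_sum, Nat.cast_sum, Finset.mul_sum]
  exact Finset.sum_le_sum fun i _ => hmain i
end
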